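/- For every δ > 0 there exists a constant c > 0, depending only on δ, with the following property. Let a ∈ ℝ and 0 < r ≤ b, and suppose the circle of Euclidean center (a, b) and radius r meets the vertical line {x = 0} at heights y₁ < y₂ and the vertical line {x = δ} at heights y₁' < y₂' (that is, a² + (y_j − b)² = r² for j = 1, 2 and (a − δ)² + (y_j' − b)² = r² for j = 1, 2), with y₁ ≥ 1 + δ and y₁' ≥ 1 + δ. Then | 2 sinh((1/2)·log(y₂/y₁)) − 2 sinh((1/2)·log(y₂'/y₁')) | ≤ c · e^{−d/2}, where d = log y₁. -/

import Mathlib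

open Real

lemma two_mul_sinh_half_log_div {x y : ℝ} (hx : 0 < x) (hy : 0 < y) :
    2 * sinh ((1 / 2) * log (y / x)) = (y - x) / √(x * y) := by
  have hlog : (1 / 2) * log (y / x) = log (√y / √x) := by
    rw [← sqrt_div hy.le, log_sqrt (by positivity)]
    ring
  have hx' := sqrt_pos.2 hx
  have hy' := sqrt_pos.2 hy
  rw [hlog, sinh_log (by positivity), sqrt_mul hx.le]
  field_simp
  rw [sq_sqrt hx.le, sq_sqrt hy.le]

/-- If the circle of center `(a, b)` and radius `r` meets a vertical line in two heights,
these have sum `2 b` and product `b ^ 2 - r ^ 2 + a ^ 2`. -/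
lemma sum_and_prod_of_circle {a b r x y : ℝ} (hx : a ^ 2 + (x - b) ^ 2 = r ^ 2)
    (hy : a ^ 2 + (y - b) ^ 2 = r ^ 2) (hxy : x < y) :
    x + y = 2 * b ∧ x * y = b ^ 2 - r ^ 2 + a ^ 2 := by
  have hsum : x + y = 2 * b := by
    have h : (y - x) * (x + y - 2 * b) = 0 := by linear_combination hy - hx
    rcases mul_eq_zero.1 h with h | h <;> linarith
  refine ⟨hsum, ?_⟩
  linear_combination x * hsum - hx

lemma sqrt_add_sq_le {k u v δ : ℝ} (hk : 0 ≤ k) (hδ : |u - v| ≤ δ) :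
    √(k + u ^ 2) ≤ √(k + v ^ 2) + δ := by
  have hδ0 : 0 ≤ δ := (abs_nonneg _).trans hδ
  have hv : |v| ≤ √(k + v ^ 2) := abs_le_sqrt (by linarith)
  have hu : |u| ≤ |v| + δ := by
    have := abs_sub_abs_le_abs_sub u v
    linarith
  have hs : √(k + v ^ 2) ^ 2 = k + v ^ 2 := sq_sqrt (by positivity)
  refine sqrt_le_iff.2 ⟨by positivity, ?_⟩
  nlinarith [sq_abs u, sq_abs v, abs_nonneg u, abs_nonneg v]

/-- Here `e` and `f` are the two excursions and `p`, `q` the geometric means of the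
corresponding entry and exit heights. -/
lemma abs_sub_mul_add_mul_cube_le {δ b p q e f : ℝ} (hδ : 0 < δ) (hp : 1 + δ ≤ p)
    (hq : 1 + δ ≤ q) (hpq : p ≤ q + δ) (hqp : q ≤ p + δ) (he : 0 ≤ e) (hf : 0 ≤ f)
    (hep : e ^ 2 * p ^ 2 = 4 * (b ^ 2 - p ^ 2)) (hfq : f ^ 2 * q ^ 2 = 4 * (b ^ 2 - q ^ 2)) :
    |e - f| * (e + f) * p ^ 3 ≤ 12 * (1 + δ) ^ 2 * δ * b ^ 2 := by
  have hp0 : 0 < p := by linarith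
  have hq0 : 0 < q := by linarith
  have hdiff : |e - f| * (e + f) * p ^ 2 * q ^ 2 = 4 * b ^ 2 * (|q - p| * (q + p)) := by
    have h : (e - f) * ((e + f) * p ^ 2 * q ^ 2) = (q - p) * (4 * b ^ 2 * (q + p)) := by
      linear_combination q ^ 2 * hep - p ^ 2 * hfq
    have h' := congrArg abs h
    rw [abs_mul, abs_mul (q - p), abs_of_nonneg (a := (e + f) * p ^ 2 * q ^ 2) (by positivity),
      abs_of_nonneg (a := 4 * b ^ 2 * (q + p)) (by positivity)] at h'
    linarith
  have hqp' : |q - p| * (q + p) ≤ δ * (3 * p) :=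
    mul_le_mul (abs_le.2 ⟨by linarith, by linarith⟩) (by linarith) (by positivity) hδ.le
  have hKq : p ≤ (1 + δ) * q := by nlinarith
  have hKq2 : p ^ 2 ≤ (1 + δ) ^ 2 * q ^ 2 := by
    rw [← mul_pow]
    exact pow_le_pow_left₀ hp0.le hKq 2
  refine le_of_mul_le_mul_right ?_ hp0
  calc |e - f| * (e + f) * p ^ 3 * p = |e - f| * (e + f) * p ^ 2 * p ^ 2 := by ring
    _ ≤ |e - f| * (e + f) * p ^ 2 * ((1 + δ) ^ 2 * q ^ 2) := by gcongr
    _ = (1 + δ) ^ 2 * (4 * b ^ 2 * (|q - p| * (q + p))) := by rw [← hdiff]; ring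
    _ ≤ (1 + δ) ^ 2 * (4 * b ^ 2 * (δ * (3 * p))) := by gcongr
    _ = 12 * (1 + δ) ^ 2 * δ * b ^ 2 * p := by ring

lemma abs_sub_mul_sqrt_le {δ b p y e f : ℝ} (hδ : 0 < δ) (hb : 0 < b) (hy : 1 ≤ y)
    (hyp : y ≤ p) (hyb : y * b ≤ p ^ 2) (he : 0 ≤ e) (hf : 0 ≤ f)
    (hep : e ^ 2 * p ^ 2 = 4 * (b ^ 2 - p ^ 2))
    (h : |e - f| * (e + f) * p ^ 3 ≤ 12 * (1 + δ) ^ 2 * δ * b ^ 2) :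
    |e - f| * √y ≤ 16 * (1 + δ) ^ 3 := by
  have hp0 : 0 < p := by linarith
  have hw : √y ^ 2 = y := sq_sqrt (by linarith)
  have hw1 : 1 ≤ √y := one_le_sqrt.2 hy
  have hD := abs_nonneg (e - f)
  have hK : 12 * (1 + δ) ^ 2 * δ ≤ 16 * (1 + δ) ^ 3 := by
    nlinarith [pow_pos (by linarith : 0 < 1 + δ) 2]
  rcases le_total b (e * p) with hcase | hcase
  · have h₁ : |e - f| * p ^ 2 ≤ 12 * (1 + δ) ^ 2 * δ * b := by
      refine le_of_mul_le_mul_right ?_ hb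
      calc |e - f| * p ^ 2 * b ≤ |e - f| * p ^ 2 * (e * p) := by gcongr
        _ = |e - f| * e * p ^ 3 := by ring
        _ ≤ |e - f| * (e + f) * p ^ 3 := by gcongr; linarith
        _ ≤ 12 * (1 + δ) ^ 2 * δ * b ^ 2 := h
        _ = _ := by ring
    have h₂ : |e - f| * y ≤ 12 * (1 + δ) ^ 2 * δ := by
      refine le_of_mul_le_mul_right ?_ hb
      calc |e - f| * y * b = |e - f| * (y * b) := by ring
        _ ≤ |e - f| * p ^ 2 := by gcongr
        _ ≤ _ := h₁
    have h₃ : √y ≤ y := by nlinarith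
    exact (mul_le_mul_of_nonneg_left h₃ hD).trans (h₂.trans hK)
  · have hbp : 3 * b ^ 2 ≤ 4 * p ^ 2 := by
      have : (e * p) ^ 2 ≤ b ^ 2 := pow_le_pow_left₀ (by positivity) hcase 2
      nlinarith
    have hef : |e - f| ≤ e + f := abs_le.2 ⟨by linarith, by linarith⟩
    have h₁ : |e - f| ^ 2 * p ≤ 16 * (1 + δ) ^ 2 * δ := by
      refine le_of_mul_le_mul_right ?_ (pow_pos hp0 2)
      calc |e - f| ^ 2 * p * p ^ 2 = |e - f| * |e - f| * p ^ 3 := by ring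
        _ ≤ |e - f| * (e + f) * p ^ 3 := by gcongr
        _ ≤ 12 * (1 + δ) ^ 2 * δ * b ^ 2 := h
        _ = 4 * (1 + δ) ^ 2 * δ * (3 * b ^ 2) := by ring
        _ ≤ 4 * (1 + δ) ^ 2 * δ * (4 * p ^ 2) := by gcongr
        _ = _ := by ring
    refine (sq_le_sq₀ (by positivity) (by positivity)).1 ?_
    calc (|e - f| * √y) ^ 2 = |e - f| ^ 2 * y := by rw [mul_pow, hw]
      _ ≤ |e - f| ^ 2 * p := by gcongr
      _ ≤ 16 * (1 + δ) ^ 2 * δ := h₁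
      _ ≤ 16 * (1 + δ) ^ 3 := by nlinarith [pow_pos (by linarith : 0 < 1 + δ) 2]
      _ ≤ (16 * (1 + δ) ^ 3) ^ 2 := by
        have : 1 ≤ (1 + δ) ^ 3 := one_le_pow₀ (by linarith)
        nlinarith

/-- Excursions of two parallel geodesics `{x = 0}` and `{x = δ}` in a common horoball
(circle of Euclidean center `(a, b)` and radius `r ≤ b`) differ by at most `c e^{-d/2}`,
where `d = log y₁` is the distance from `i` to the entry point `i y₁`. -/
theorem excursion_difference_parallel_geodesics (δ : ℝ) (hδ : 0 < δ) :
    ∃ c : ℝ, 0 < c ∧ ∀ a b r y₁ y₂ y₁' y₂' : ℝ,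
      0 < r → r ≤ b →
      a ^ 2 + (y₁ - b) ^ 2 = r ^ 2 → a ^ 2 + (y₂ - b) ^ 2 = r ^ 2 →
      (a - δ) ^ 2 + (y₁' - b) ^ 2 = r ^ 2 → (a - δ) ^ 2 + (y₂' - b) ^ 2 = r ^ 2 →
      y₁ < y₂ → y₁' < y₂' → 1 + δ ≤ y₁ → 1 + δ ≤ y₁' →
      |2 * Real.sinh ((1 / 2) * Real.log (y₂ / y₁)) -
          2 * Real.sinh ((1 / 2) * Real.log (y₂' / y₁'))| ≤
        c * Real.exp (-(Real.log y₁) / 2) := by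
  refine ⟨16 * (1 + δ) ^ 3, by positivity, ?_⟩
  intro a b r y₁ y₂ y₁' y₂' hr hrb h₁ h₂ h₁' h₂' hlt hlt' hy hy'
  obtain ⟨hsum, hprod⟩ := sum_and_prod_of_circle h₁ h₂ hlt
  obtain ⟨hsum', hprod'⟩ := sum_and_prod_of_circle h₁' h₂' hlt'
  have hy0 : 0 < y₁ := by linarith
  have hy0' : 0 < y₁' := by linarith
  have hk : 0 ≤ b ^ 2 - r ^ 2 := by nlinarith
  have hexp : exp (-(log y₁) / 2) = (√y₁)⁻¹ := by
    rw [neg_div, exp_neg, ← log_sqrt hy0.le, exp_log (sqrt_pos.2 hy0)]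
  rw [two_mul_sinh_half_log_div hy0 (hy0.trans hlt),
    two_mul_sinh_half_log_div hy0' (hy0'.trans hlt'), hexp, ← div_eq_mul_inv,
    le_div_iff₀ (sqrt_pos.2 hy0)]
  have hyp : y₁ ≤ √(y₁ * y₂) := le_sqrt_of_sq_le (by nlinarith)
  have hyq : y₁' ≤ √(y₁' * y₂') := le_sqrt_of_sq_le (by nlinarith)
  have hpq : √(y₁ * y₂) ≤ √(y₁' * y₂') + δ := by
    rw [hprod, hprod']
    exact sqrt_add_sq_le hk (by rw [sub_sub_cancel, abs_of_pos hδ])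
  have hqp : √(y₁' * y₂') ≤ √(y₁ * y₂) + δ := by
    rw [hprod, hprod']
    exact sqrt_add_sq_le hk (by rw [sub_sub_cancel_left, abs_neg, abs_of_pos hδ])
  have hp2 : √(y₁ * y₂) ^ 2 = y₁ * y₂ := sq_sqrt (by nlinarith)
  have hq2 : √(y₁' * y₂') ^ 2 = y₁' * y₂' := sq_sqrt (by nlinarith)
  have he : 0 ≤ (y₂ - y₁) / √(y₁ * y₂) := div_nonneg (by linarith) (sqrt_nonneg _)
  have hf : 0 ≤ (y₂' - y₁') / √(y₁' * y₂') := div_nonneg (by linarith) (sqrt_nonneg _)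
  have hep : ((y₂ - y₁) / √(y₁ * y₂)) ^ 2 * √(y₁ * y₂) ^ 2 =
      4 * (b ^ 2 - √(y₁ * y₂) ^ 2) := by
    rw [← mul_pow, div_mul_cancel₀ _ (by linarith), hp2]
    linear_combination (y₁ + y₂ + 2 * b) * hsum
  have hfq : ((y₂' - y₁') / √(y₁' * y₂')) ^ 2 * √(y₁' * y₂') ^ 2 =
      4 * (b ^ 2 - √(y₁' * y₂') ^ 2) := by
    rw [← mul_pow, div_mul_cancel₀ _ (by linarith), hq2]
    linear_combination (y₁' + y₂' + 2 * b) * hsum'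
  exact abs_sub_mul_sqrt_le hδ (by linarith) (by linarith) hyp (by rw [hp2]; nlinarith) he hf hep
    (abs_sub_mul_add_mul_cube_le hδ (by linarith) (by linarith) hpq hqp he hf hep hfq)
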